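/- arXiv:2605.26413 — 7 statements merged into one kernel-verified Lean document; each statement's English description precedes it below -/
import Mathlib

section
/- Let g : ℝ → ℝ be a probability density with respect to Lebesgue measure (nonnegative, measurable, integral 1), and let π : ℝ → ℝ be measurable and nondecreasing with 0 ≤ π(u) ≤ 1 for all u. Suppose c₁ := ∫ π(u) g(u) du satisfies 0 < c₁ < 1, and set c₀ := 1 − c₁ = ∫ (1 − π(u)) g(u) du. Define the posterior densities f₁(u) := π(u) g(u) / c₁ and f₀(u) := (1 − π(u)) g(u) / c₀. Then for every bounded Borel-measurable nondecreasing function φ : ℝ → ℝ, ∫ φ(u) f₁(u) du ≥ ∫ φ(u) f₀(u) du; i.e., the measure with density f₁ stochastically dominates the measure with density f₀. -/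
open MeasureTheory

/-- Proposition 1 (Z-matching via monotone likelihood ratio): the Bayes posteriors
`f₁ ∝ π g` and `f₀ ∝ (1 - π) g` arising from a prior density `g` and a nondecreasing
propensity `π` are stochastically ordered. -/
theorem stmt0
    (g : ℝ → ℝ) (hg_nn : ∀ u, 0 ≤ g u) (hg_meas : Measurable g)
    (hg_int : ∫ u, g u = 1)
    (π : ℝ → ℝ) (hπ_meas : Measurable π) (hπ_mono : Monotone π)
    (hπ01 : ∀ u, 0 ≤ π u ∧ π u ≤ 1)
    (c₁ c₀ : ℝ) (hc₁ : c₁ = ∫ u, π u * g u)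
    (hc₁_pos : 0 < c₁) (hc₁_lt : c₁ < 1) (hc₀ : c₀ = 1 - c₁)
    (f₁ f₀ : ℝ → ℝ)
    (hf₁ : ∀ u, f₁ u = π u * g u / c₁)
    (hf₀ : ∀ u, f₀ u = (1 - π u) * g u / c₀)
    (φ : ℝ → ℝ) (hφ_meas : Measurable φ) (hφ_mono : Monotone φ)
    (hφ_bdd : ∃ C, ∀ u, |φ u| ≤ C) :
    ∫ u, φ u * f₀ u ≤ ∫ u, φ u * f₁ u := by
  obtain ⟨C, hC⟩ := hφ_bdd
  have hg : Integrable g := by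
    by_contra h
    rw [integral_undef h] at hg_int
    exact zero_ne_one hg_int
  have hπg : Integrable (fun u => π u * g u) := by
    refine hg.bdd_mul (c := 1) hπ_meas.aestronglyMeasurable (Filter.Eventually.of_forall fun u => ?_)
    rw [Real.norm_eq_abs, abs_of_nonneg (hπ01 u).1]
    exact (hπ01 u).2
  have hφπg : Integrable (fun u => φ u * (π u * g u)) :=
    hπg.bdd_mul (c := C) hφ_meas.aestronglyMeasurable (Filter.Eventually.of_forall hC)
  have hφg : Integrable (fun u => φ u * g u) :=
    hg.bdd_mul (c := C) hφ_meas.aestronglyMeasurable (Filter.Eventually.of_forall hC)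
  have ha : ∃ a : ℝ, ∀ u, 0 ≤ (φ u - a) * (π u - c₁) := by
    by_cases hS : ∃ u, π u < c₁
    · obtain ⟨u0, hu0⟩ := hS
      refine ⟨sSup (φ '' {u | π u < c₁}), fun u => ?_⟩
      by_cases hu : π u < c₁
      · have : φ u ≤ sSup (φ '' {u | π u < c₁}) := by
          apply le_csSup
          · refine ⟨C, ?_⟩
            rintro _ ⟨v, _, rfl⟩
            exact (abs_le.1 (hC v)).2
          · exact ⟨u, hu, rfl⟩
        exact mul_nonneg_of_nonpos_of_nonpos (by linarith) (by linarith)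
      · have : sSup (φ '' {u | π u < c₁}) ≤ φ u := by
          refine csSup_le (Set.Nonempty.image φ ⟨u0, hu0⟩) ?_
          rintro _ ⟨v, hv, rfl⟩
          apply hφ_mono
          by_contra h
          exact hu (lt_of_le_of_lt (hπ_mono (le_of_not_ge h)) hv)
        exact mul_nonneg (by linarith) (by linarith)
    · push Not at hS
      refine ⟨-C, fun u => mul_nonneg ?_ ?_⟩
      · linarith [(abs_le.1 (hC u)).1]
      · linarith [hS u]
  obtain ⟨a, ha⟩ := ha
  have key : 0 ≤ ∫ u, ((φ u * (π u * g u) - c₁ * (φ u * g u)) - (a * (π u * g u) - a * c₁ * g u)) := by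
    apply integral_nonneg
    intro u
    have := mul_nonneg (ha u) (hg_nn u)
    simp only [Pi.zero_apply]
    nlinarith
  have i1 : Integrable (fun u => φ u * (π u * g u) - c₁ * (φ u * g u)) :=
    hφπg.sub (hφg.const_mul _)
  have i2 : Integrable (fun u => a * (π u * g u) - a * c₁ * g u) :=
    (hπg.const_mul _).sub (hg.const_mul _)
  rw [integral_sub i1 i2,
    integral_sub hφπg (hφg.const_mul _), integral_sub (hπg.const_mul _) (hg.const_mul _),
    integral_const_mul, integral_const_mul, integral_const_mul, ← hc₁, hg_int] at key
  have h0 : 0 < c₀ := by linarith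
  have e1 : ∫ u, φ u * f₁ u = (∫ u, φ u * (π u * g u)) / c₁ := by
    rw [← integral_div]
    congr 1; ext u; rw [hf₁]; ring
  have e0 : ∫ u, φ u * f₀ u = ((∫ u, φ u * g u) - ∫ u, φ u * (π u * g u)) / c₀ := by
    rw [← integral_sub hφg hφπg, ← integral_div]
    congr 1; ext u; rw [hf₀]; ring
  rw [e1, e0, div_le_div_iff₀ h0 hc₁_pos, hc₀]
  nlinarith
end

section
/- (Karlin–Rinott) Let d ≥ 1 and let f₀, f₁ : ℝᵈ → ℝ be probability densities with respect to Lebesgue measure on ℝᵈ satisfying the four-point condition f₀(u) · f₁(u') ≤ f₀(u ⊓ u') · f₁(u ⊔ u') for all u, u' ∈ ℝᵈ, where ⊓ and ⊔ denote coordinatewise minimum and maximum. Then the measure with density f₁ stochastically dominates the measure with density f₀: for every bounded Borel-measurable function φ : ℝᵈ → ℝ that is nondecreasing with respect to the coordinatewise partial order, ∫ φ f₁ dλ ≥ ∫ φ f₀ dλ. -/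
open MeasureTheory

lemma aux_alg (A B P Q : ENNReal) (hA : A ≤ P) (hB : B ≤ P) (h : A * B ≤ P * Q) :
    A + B ≤ P + Q := by
  by_cases hP : P = ⊤
  · simp [hP]
  by_cases hQ : Q = ⊤
  · simp [hQ]
  have hA' : A ≠ ⊤ := ne_top_of_le_ne_top hP hA
  have hB' : B ≠ ⊤ := ne_top_of_le_ne_top hP hB
  lift A to NNReal using hA'
  lift B to NNReal using hB'
  lift P to NNReal using hP
  lift Q to NNReal using hQ
  norm_cast at *
  have hA2 : (A : ℝ) ≤ P := by exact_mod_cast hA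
  have hB2 : (B : ℝ) ≤ P := by exact_mod_cast hB
  have h2 : (A : ℝ) * B ≤ P * Q := by exact_mod_cast h
  have : (A : ℝ) + B ≤ P + Q := by
    rcases eq_or_lt_of_le (P.coe_nonneg) with h0 | h0
    · have := Q.coe_nonneg
      linarith
    · refine le_of_mul_le_mul_left ?_ h0
      nlinarith [mul_nonneg (sub_nonneg.2 hA2) (sub_nonneg.2 hB2)]
  exact_mod_cast this

lemma aux_pt (a b c e : ℝ → ENNReal)
    (h : ∀ x y, a x * b y ≤ c (x ⊓ y) * e (x ⊔ y)) (x y : ℝ) :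
    a x * b y + a y * b x ≤ c x * e y + c y * e x := by
  have key : ∀ x y : ℝ, x ≤ y → a x * b y + a y * b x ≤ c x * e y + c y * e x := by
    intro x y hxy
    apply aux_alg
    · simpa [hxy] using h x y
    · simpa [hxy] using h y x
    · have h1 := h x x
      have h2 := h y y
      simp only [inf_idem, sup_idem] at h1 h2
      calc a x * b y * (a y * b x) = (a x * b x) * (a y * b y) := by ring
        _ ≤ (c x * e x) * (c y * e y) := mul_le_mul' h1 h2
        _ = _ := by ring
  rcases le_total x y with hxy | hxy
  · exact key x y hxy
  · rw [add_comm, add_comm (c x * e y)]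
    exact key y x hxy

lemma aux_sym (a b : ℝ → ENNReal) (ha : Measurable a) (hb : Measurable b) :
    ∫⁻ x, ∫⁻ y, (a x * b y + a y * b x) = 2 * ((∫⁻ x, a x) * ∫⁻ x, b x) := by
  have : ∀ x, ∫⁻ y, (a x * b y + a y * b x) = a x * (∫⁻ y, b y) + (∫⁻ y, a y) * b x := by
    intro x
    rw [lintegral_add_left (by fun_prop), lintegral_const_mul _ hb, lintegral_mul_const _ ha]
  simp_rw [this]
  rw [lintegral_add_left (by fun_prop), lintegral_const_mul _ hb, lintegral_mul_const _ ha, two_mul]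

lemma aux_one (a b c e : ℝ → ENNReal) (ha : Measurable a) (hb : Measurable b)
    (hc : Measurable c) (he : Measurable e)
    (h : ∀ x y, a x * b y ≤ c (x ⊓ y) * e (x ⊔ y)) :
    (∫⁻ x, a x) * ∫⁻ x, b x ≤ (∫⁻ x, c x) * ∫⁻ x, e x := by
  have h1 : ∫⁻ x, ∫⁻ y, (a x * b y + a y * b x) ≤ ∫⁻ x, ∫⁻ y, (c x * e y + c y * e x) :=
    lintegral_mono fun x => lintegral_mono fun y => aux_pt a b c e h x y
  rw [aux_sym a b ha hb, aux_sym c e hc he] at h1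
  exact (ENNReal.mul_le_mul_iff_right (by simp) (by simp)).1 h1

lemma aux_cons_meas (d : ℕ) : Measurable fun p : ℝ × (Fin d → ℝ) =>
    (Fin.cons p.1 p.2 : Fin (d + 1) → ℝ) := by
  refine measurable_pi_lambda _ fun i => ?_
  refine Fin.cases ?_ (fun j => ?_) i
  · simpa using measurable_fst
  · simp only [Fin.cons_succ]
    fun_prop

lemma aux_fubini (d : ℕ) (a : (Fin (d + 1) → ℝ) → ENNReal) (ha : Measurable a) :
    ∫⁻ x, a x = ∫⁻ y : Fin d → ℝ, ∫⁻ t : ℝ, a (Fin.cons t y) := by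
  have h := (volume_preserving_piFinSuccAbove (fun _ : Fin (d + 1) => ℝ) 0).symm
  rw [← h.lintegral_comp ha, Measure.volume_eq_prod, lintegral_prod_symm]
  · simp [MeasurableEquiv.piFinSuccAbove, Fin.insertNthEquiv]
  · exact (ha.comp (MeasurableEquiv.measurable _)).aemeasurable

lemma aux_four (d : ℕ) : ∀ (a b c e : (Fin d → ℝ) → ENNReal), Measurable a → Measurable b →
    Measurable c → Measurable e → (∀ x y, a x * b y ≤ c (x ⊓ y) * e (x ⊔ y)) →
    (∫⁻ x, a x) * ∫⁻ x, b x ≤ (∫⁻ x, c x) * ∫⁻ x, e x := by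
  induction d with
  | zero =>
    intro a b c e ha hb hc he h
    have hv : ∀ f : (Fin 0 → ℝ) → ENNReal, Measurable f → ∫⁻ x, f x = f default := by
      intro f hf
      rw [volume_pi, Measure.pi_of_empty (x := default), lintegral_dirac' _ hf]
    rw [hv a ha, hv b hb, hv c hc, hv e he]
    convert h default default using 3
  | succ d ih =>
    intro a b c e ha hb hc he h
    rw [aux_fubini d a ha, aux_fubini d b hb, aux_fubini d c hc, aux_fubini d e he]
    have hm : ∀ a : (Fin (d + 1) → ℝ) → ENNReal, Measurable a →
        Measurable fun y : Fin d → ℝ => ∫⁻ t : ℝ, a (Fin.cons t y) := fun a ha =>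
      (ha.comp (aux_cons_meas d)).lintegral_prod_left'
    have hs : ∀ a : (Fin (d + 1) → ℝ) → ENNReal, Measurable a → ∀ y : Fin d → ℝ,
        Measurable fun t : ℝ => a (Fin.cons t y) := fun a ha y =>
      (ha.comp (aux_cons_meas d)).comp (measurable_id.prodMk measurable_const)
    apply ih _ _ _ _ (hm a ha) (hm b hb) (hm c hc) (hm e he)
    intro x y
    apply aux_one _ _ _ _ (hs a ha x) (hs b hb y) (hs c hc _) (hs e he _)
    intro s t
    convert h (Fin.cons s x) (Fin.cons t y) using 3
    · ext i; refine Fin.cases ?_ (fun j => ?_) i <;> simp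
    · ext i; refine Fin.cases ?_ (fun j => ?_) i <;> simp

/-- Karlin–Rinott: if two probability densities on ℝᵈ satisfy the four-point condition
`f₀ u * f₁ u' ≤ f₀ (u ⊓ u') * f₁ (u ⊔ u')`, then the measure with density `f₁`
stochastically dominates the measure with density `f₀`. -/
theorem stmt2 (d : ℕ) (hd : 1 ≤ d)
    (f₀ f₁ : (Fin d → ℝ) → ℝ)
    (hf₀_nn : ∀ u, 0 ≤ f₀ u) (hf₀_meas : Measurable f₀) (hf₀_int : ∫ u, f₀ u = 1)
    (hf₁_nn : ∀ u, 0 ≤ f₁ u) (hf₁_meas : Measurable f₁) (hf₁_int : ∫ u, f₁ u = 1)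
    (hkr : ∀ u u' : Fin d → ℝ, f₀ u * f₁ u' ≤ f₀ (u ⊓ u') * f₁ (u ⊔ u'))
    (φ : (Fin d → ℝ) → ℝ) (hφ_meas : Measurable φ) (hφ_mono : Monotone φ)
    (hφ_bdd : ∃ C, ∀ u, |φ u| ≤ C) :
    ∫ u, φ u * f₀ u ≤ ∫ u, φ u * f₁ u := by
  obtain ⟨C, hC⟩ := hφ_bdd
  have hi : ∀ f : (Fin d → ℝ) → ℝ, ∫ u, f u = 1 → Integrable f := by
    intro f hf
    by_contra hn
    rw [integral_undef hn] at hf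
    exact zero_ne_one hf
  have i0 := hi f₀ hf₀_int
  have i1 := hi f₁ hf₁_int
  have hφi : ∀ f : (Fin d → ℝ) → ℝ, Integrable f → Integrable (fun u => φ u * f u) := by
    intro f hf
    exact hf.bdd_mul hφ_meas.aestronglyMeasurable (Filter.Eventually.of_forall hC)
  have hψ : ∀ u, 0 ≤ φ u + C := fun u => by linarith [neg_le_of_abs_le (hC u)]
  have hψi : ∀ f : (Fin d → ℝ) → ℝ, Integrable f → Integrable (fun u => (φ u + C) * f u) := by
    intro f hf
    simp only [add_mul]
    exact (hφi f hf).add (hf.const_mul C)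
  have hsplit : ∀ f : (Fin d → ℝ) → ℝ, ∫ u, f u = 1 →
      ∫ u, (φ u + C) * f u = (∫ u, φ u * f u) + C := by
    intro f hf
    simp only [add_mul]
    rw [integral_add (hφi f (hi f hf)) ((hi f hf).const_mul C), integral_const_mul, hf, mul_one]
  have hl : ∀ f : (Fin d → ℝ) → ℝ, (∀ u, 0 ≤ f u) → ∫ u, f u = 1 →
      ∫⁻ u, ENNReal.ofReal (f u) = 1 := by
    intro f hf h1
    rw [← ofReal_integral_eq_lintegral_ofReal (hi f h1) (Filter.Eventually.of_forall hf), h1]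
    simp
  have key := aux_four d (fun u => ENNReal.ofReal ((φ u + C) * f₀ u))
    (fun u => ENNReal.ofReal (f₁ u)) (fun u => ENNReal.ofReal (f₀ u))
    (fun u => ENNReal.ofReal ((φ u + C) * f₁ u)) (by fun_prop) (by fun_prop) (by fun_prop)
    (by fun_prop) (by
      intro x y
      rw [← ENNReal.ofReal_mul (mul_nonneg (hψ x) (hf₀_nn x)), ← ENNReal.ofReal_mul (hf₀_nn _)]
      apply ENNReal.ofReal_le_ofReal
      have hm : φ x + C ≤ φ (x ⊔ y) + C := by linarith [hφ_mono (le_sup_left : x ≤ x ⊔ y)]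
      calc (φ x + C) * f₀ x * f₁ y = (φ x + C) * (f₀ x * f₁ y) := by ring
        _ ≤ (φ (x ⊔ y) + C) * (f₀ (x ⊓ y) * f₁ (x ⊔ y)) :=
          mul_le_mul hm (hkr x y) (mul_nonneg (hf₀_nn _) (hf₁_nn _)) (hψ _)
        _ = _ := by ring)
  rw [hl f₀ hf₀_nn hf₀_int, hl f₁ hf₁_nn hf₁_int, mul_one, one_mul,
    ← ofReal_integral_eq_lintegral_ofReal (hψi f₀ i0)
      (Filter.Eventually.of_forall fun u => mul_nonneg (hψ u) (hf₀_nn u)),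
    ← ofReal_integral_eq_lintegral_ofReal (hψi f₁ i1)
      (Filter.Eventually.of_forall fun u => mul_nonneg (hψ u) (hf₁_nn u)),
    ENNReal.ofReal_le_ofReal_iff
      (integral_nonneg fun u => mul_nonneg (hψ u) (hf₁_nn u)),
    hsplit f₀ hf₀_int, hsplit f₁ hf₁_int] at key
  linarith
end

section
/- Let d ≥ 1, let g : ℝᵈ → ℝ be nonnegative and log-supermodular (g(u) g(u') ≤ g(u ⊓ u') g(u ⊔ u') for all u, u'), and let π : ℝᵈ → ℝ satisfy 0 ≤ π ≤ 1 and be nondecreasing with respect to the coordinatewise partial order. Then for all u, u' ∈ ℝᵈ: (1 − π(u)) g(u) · π(u') g(u') ≤ (1 − π(u ⊓ u')) g(u ⊓ u') · π(u ⊔ u') g(u ⊔ u'). -/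
/-- Verification (proof of Proposition 2) that the unnormalized posteriors
`((1 - π) g, π g)` satisfy the Karlin–Rinott four-point condition, given `g`
log-supermodular and `π` coordinatewise nondecreasing with values in `[0, 1]`. -/
theorem stmt4 (d : ℕ) (hd : 1 ≤ d)
    (g : (Fin d → ℝ) → ℝ) (hg_nn : ∀ u, 0 ≤ g u)
    (hg_lsm : ∀ u u' : Fin d → ℝ, g u * g u' ≤ g (u ⊓ u') * g (u ⊔ u'))
    (π : (Fin d → ℝ) → ℝ) (hπ01 : ∀ u, 0 ≤ π u ∧ π u ≤ 1) (hπ_mono : Monotone π)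
    (u u' : Fin d → ℝ) :
    (1 - π u) * g u * (π u' * g u')
      ≤ (1 - π (u ⊓ u')) * g (u ⊓ u') * (π (u ⊔ u') * g (u ⊔ u')) := by
  have h1 : π (u ⊓ u') ≤ π u := hπ_mono inf_le_left
  have h2 : π u' ≤ π (u ⊔ u') := hπ_mono le_sup_right
  have h3 : (1 - π u) * π u' ≤ (1 - π (u ⊓ u')) * π (u ⊔ u') :=
    mul_le_mul (by linarith) h2 (hπ01 u').1 (by linarith [(hπ01 (u ⊓ u')).2])
  have h4 : 0 ≤ (1 - π (u ⊓ u')) * π (u ⊔ u') :=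
    mul_nonneg (by linarith [(hπ01 (u ⊓ u')).2]) (hπ01 _).1
  have h5 := mul_le_mul h3 (hg_lsm u u') (mul_nonneg (hg_nn u) (hg_nn u')) h4
  linarith [h5]
end

section
/- Let n ≥ 1 and let f : ℝⁿ → ℝ be twice continuously differentiable with all mixed second partial derivatives nonnegative: ∂²f/∂xᵢ∂xⱼ (x) ≥ 0 for all i ≠ j and all x ∈ ℝⁿ. Then f is supermodular: f(x) + f(y) ≤ f(x ⊓ y) + f(x ⊔ y) for all x, y ∈ ℝⁿ, where ⊓ and ⊔ denote coordinatewise minimum and maximum. -/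
theorem aux_mono {n : ℕ} (G : (Fin n → ℝ) → ℝ) (hG : Differentiable ℝ G) (w : Fin n → ℝ)
    (h : ∀ z, ∀ j, 0 ≤ w j * fderiv ℝ G z (Pi.single j 1)) (p : Fin n → ℝ) :
    G p ≤ G (p + w) := by
  have hd : ∀ t : ℝ, HasDerivAt (fun t : ℝ => G (p + t • w)) (fderiv ℝ G (p + t • w) w) t := by
    intro t
    have h1 : HasDerivAt (fun t : ℝ => p + t • w) w t := by
      simpa using ((hasDerivAt_id t).smul_const w).const_add p
    exact (hG (p + t • w)).hasFDerivAt.comp_hasDerivAt t h1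
  have hm : Monotone (fun t : ℝ => G (p + t • w)) := by
    apply monotone_of_deriv_nonneg (fun t => (hd t).differentiableAt)
    intro t
    rw [(hd t).deriv]
    have hw : w = ∑ j, w j • (Pi.single j (1 : ℝ) : Fin n → ℝ) := by
      ext k
      simp [Finset.sum_apply, Pi.single_apply]
    have h2 : fderiv ℝ G (p + t • w) w
        = ∑ j, w j * fderiv ℝ G (p + t • w) (Pi.single j 1) := by
      conv_lhs => rw [hw]
      rw [map_sum]
      simp only [map_smul, smul_eq_mul, ← hw]
    rw [h2]
    exact Finset.sum_nonneg fun j _ => h _ j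
  simpa using hm (zero_le_one : (0 : ℝ) ≤ 1)

/-- Integration-along-axis-aligned-paths step (proof of Proposition 4): a C² function
on ℝⁿ with nonnegative mixed second partial derivatives is supermodular. -/
theorem stmt7 (n : ℕ) (hn : 1 ≤ n)
    (f : (Fin n → ℝ) → ℝ) (hf : ContDiff ℝ 2 f)
    (hcross : ∀ i j : Fin n, i ≠ j → ∀ x : Fin n → ℝ,
      0 ≤ fderiv ℝ (fun y => fderiv ℝ f y (Pi.single i 1)) x (Pi.single j 1))
    (x y : Fin n → ℝ) :
    f x + f y ≤ f (x ⊓ y) + f (x ⊔ y) := by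
  have hfd : Differentiable ℝ f := hf.differentiable (by norm_num)
  have hf1 : Differentiable ℝ (fderiv ℝ f) :=
    (hf.fderiv_right (m := 1) (by norm_num)).differentiable (by norm_num)
  obtain ⟨u, hu⟩ : ∃ u, u = x - x ⊓ y := ⟨_, rfl⟩
  obtain ⟨v, hv⟩ : ∃ v, v = y - x ⊓ y := ⟨_, rfl⟩
  have hu0 : ∀ i, 0 ≤ u i := fun i => by simp [hu]
  have hv0 : ∀ i, 0 ≤ v i := fun i => by simp [hv]
  have huv : ∀ i, u i = 0 ∨ v i = 0 := fun i => by
    rcases le_total (x i) (y i) with h | h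
    · left; simp [hu, h]
    · right; simp [hv, h]
  have hx : x = x ⊓ y + u := by simp [hu]
  have hy : y = x ⊓ y + v := by simp [hv]
  have hs : x ⊔ y = x ⊓ y + u + v := by
    ext i
    have := min_add_max (x i) (y i)
    simp [hu, hv]
    linarith
  have key := aux_mono (fun z => f (z + v) - f z) (by fun_prop) u (by
    intro z i
    rcases huv i with h | h
    · simp [h]
    refine mul_nonneg (hu0 i) ?_
    have e : fderiv ℝ (fun z => f (z + v) - f z) z = fderiv ℝ f (z + v) - fderiv ℝ f z := by
      rw [fderiv_fun_sub (by fun_prop) (by fun_prop), fderiv_comp_add_right]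
    rw [e, sub_apply, sub_nonneg]
    refine aux_mono (fun z => fderiv ℝ f z (Pi.single i 1)) (by fun_prop) v ?_ z
    intro z j
    by_cases hij : i = j
    · subst hij; simp [h]
    · exact mul_nonneg (hv0 j) (hcross i j hij z)) (x ⊓ y)
  rw [← hs, ← hx, ← hy] at key
  linarith
end

section
/- Let m, d ≥ 1 and let h : ℝᵐ × ℝᵈ → ℝ be strictly positive with log h twice continuously differentiable, satisfying ∂² log h / ∂u⁽ʲ⁾∂u⁽ᵏ⁾ (z, u) ≥ 0 for all j ≠ k and ∂² log h / ∂z⁽ˡ⁾∂u⁽ʲ⁾ (z, u) ≤ 0 for all l, j, at every (z, u). Suppose further that for each z the function u ↦ h(z, u) is Lebesgue-integrable with 0 < ∫ h(z, u) du < ∞. Then for all z', z ∈ ℝᵐ with z' ≤ z coordinatewise, the probability measure with density u ↦ h(z', u) / ∫ h(z', ·) stochastically dominates the probability measure with density u ↦ h(z, u) / ∫ h(z, ·): for every bounded Borel-measurable coordinatewise-nondecreasing φ : ℝᵈ → ℝ, the corresponding integrals are ordered. -/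
open MeasureTheory

open scoped ENNReal

lemma aux_alg_s8 (a b A B : ℝ≥0∞) (h1 : a ≤ A) (h2 : b ≤ A) (h3 : a * b ≤ A * B) :
    a + b ≤ A + B := by
  by_cases hA : A = ∞
  · simp [hA]
  by_cases hB : B = ∞
  · simp [hB]
  have ha : a ≠ ∞ := ne_top_of_le_ne_top hA h1
  have hb : b ≠ ∞ := ne_top_of_le_ne_top hA h2
  lift A to NNReal using hA
  lift B to NNReal using hB
  lift a to NNReal using ha
  lift b to NNReal using hb
  norm_cast at *
  rcases eq_or_ne A 0 with h0 | h0
  · subst h0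
    have := le_antisymm h1 (zero_le)
    have := le_antisymm h2 (zero_le)
    simp_all
  · have hp : (0:ℝ) < A := by positivity
    have h1' : (a:ℝ) ≤ A := h1
    have h2' : (b:ℝ) ≤ A := h2
    have h3' : (a:ℝ) * b ≤ A * B := by exact_mod_cast h3
    have : (a:ℝ) + b ≤ A + B := by
      have : (A:ℝ) * (a + b) ≤ A * (A + B) := by nlinarith
      exact le_of_mul_le_mul_left this hp
    exact_mod_cast this

lemma aux_double (f g : ℝ → ℝ≥0∞) (hf : Measurable f) (hg : Measurable g) :
    (∫⁻ x, f x) * (∫⁻ x, g x) =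
      ∫⁻ p in {p : ℝ × ℝ | p.1 < p.2}, (f p.1 * g p.2 + f p.2 * g p.1) := by
  have hm : Measurable (fun p : ℝ × ℝ => f p.1 * g p.2) := by fun_prop
  have hs1 : MeasurableSet {p : ℝ × ℝ | p.1 < p.2} := measurableSet_lt (by fun_prop) (by fun_prop)
  have hs2 : MeasurableSet {p : ℝ × ℝ | p.2 < p.1} := measurableSet_lt (by fun_prop) (by fun_prop)
  have hs3 : MeasurableSet {p : ℝ × ℝ | p.1 = p.2} := measurableSet_eq_fun (by fun_prop) (by fun_prop)
  have hdiag : (volume : Measure (ℝ × ℝ)) {p : ℝ × ℝ | p.1 = p.2} = 0 := by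
    rw [Measure.volume_eq_prod, Measure.measure_prod_null hs3]
    filter_upwards with x
    have : Prod.mk x ⁻¹' {p : ℝ × ℝ | p.1 = p.2} = {x} := by
      ext y; simp [eq_comm]
    rw [this]; simp
  have hsw : ∫⁻ p in {p : ℝ × ℝ | p.1 < p.2}, f p.2 * g p.1 =
      ∫⁻ p in {p : ℝ × ℝ | p.2 < p.1}, f p.1 * g p.2 := by
    have mp : MeasurePreserving (Prod.swap : ℝ × ℝ → ℝ × ℝ) volume volume :=
      Measure.measurePreserving_swap
    have := mp.setLIntegral_comp_preimage hs2 hm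
    simpa using this
  rw [lintegral_add_left hm, hsw, ← lintegral_prod_mul hf.aemeasurable hg.aemeasurable,
    ← Measure.volume_eq_prod, ← lintegral_union hs2]
  · rw [← setLIntegral_univ]
    apply setLIntegral_congr
    have : ({p : ℝ × ℝ | p.1 < p.2} ∪ {p : ℝ × ℝ | p.2 < p.1}) = {p : ℝ × ℝ | p.1 = p.2}ᶜ := by
      ext p; simp
    rw [this]
    symm
    rw [ae_eq_univ, compl_compl, hdiag]
  · rw [Set.disjoint_left]
    intro p hp hp'
    have q1 : p.1 < p.2 := hp
    have q2 : p.2 < p.1 := hp'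
    exact lt_asymm q1 q2

lemma aux_one_s8 (f1 f2 f3 f4 : ℝ → ℝ≥0∞) (h1 : Measurable f1) (h2 : Measurable f2)
    (h3 : Measurable f3) (h4 : Measurable f4)
    (h : ∀ x y, f1 x * f2 y ≤ f3 (x ⊔ y) * f4 (x ⊓ y)) :
    (∫⁻ x, f1 x) * (∫⁻ x, f2 x) ≤ (∫⁻ x, f3 x) * (∫⁻ x, f4 x) := by
  rw [aux_double f1 f2 h1 h2, aux_double f3 f4 h3 h4]
  have hs1 : MeasurableSet {p : ℝ × ℝ | p.1 < p.2} := measurableSet_lt (by fun_prop) (by fun_prop)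
  apply setLIntegral_mono' hs1
  rintro ⟨x, y⟩ hp
  have hp : x < y := hp
  have e1 := h x y
  have e2 := h y x
  have e3 := h x x
  have e4 := h y y
  simp only [sup_of_le_right hp.le, inf_of_le_left hp.le, sup_of_le_left hp.le,
    inf_of_le_right hp.le, sup_idem, inf_idem] at e1 e2 e3 e4
  dsimp only
  rw [add_comm (f3 x * f4 y)]
  apply aux_alg_s8 _ _ _ _ e1 e2
  calc f1 x * f2 y * (f1 y * f2 x) = (f1 x * f2 x) * (f1 y * f2 y) := by ring
    _ ≤ (f3 x * f4 x) * (f3 y * f4 y) := mul_le_mul' e3 e4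
    _ = _ := by ring

lemma aux_split (n : ℕ) (f : (Fin (n+1) → ℝ) → ℝ≥0∞) (hf : Measurable f) :
    ∫⁻ x, f x = ∫⁻ t : ℝ, ∫⁻ x : Fin n → ℝ, f (Fin.cons t x) := by
  have mp := (volume_preserving_piFinSuccAbove (fun _ : Fin (n+1) => ℝ) 0).symm
  rw [← mp.lintegral_comp hf, Measure.volume_eq_prod, lintegral_prod]
  · have e : ∀ (t : ℝ) (x : Fin n → ℝ),
        (MeasurableEquiv.piFinSuccAbove (fun _ : Fin (n+1) => ℝ) 0).symm (t, x) =
          (Fin.cons t x : Fin (n+1) → ℝ) := by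
      intro t x
      simp [MeasurableEquiv.piFinSuccAbove, Fin.insertNthEquiv]
    simp only [e]
  · exact (hf.comp mp.measurable).aemeasurable

lemma aux_meas_cons (n : ℕ) :
    Measurable (fun p : ℝ × (Fin n → ℝ) => (Fin.cons p.1 p.2 : Fin (n+1) → ℝ)) := by
  rw [measurable_pi_iff]
  intro i
  refine Fin.cases ?_ (fun j => ?_) i
  · simpa using measurable_fst
  · simp only [Fin.cons_succ]
    exact (measurable_pi_apply j).comp measurable_snd

lemma aux_four_s8 (n : ℕ) : ∀ (f1 f2 f3 f4 : (Fin n → ℝ) → ℝ≥0∞), Measurable f1 → Measurable f2 →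
    Measurable f3 → Measurable f4 →
    (∀ x y, f1 x * f2 y ≤ f3 (x ⊔ y) * f4 (x ⊓ y)) →
    (∫⁻ x, f1 x) * (∫⁻ x, f2 x) ≤ (∫⁻ x, f3 x) * (∫⁻ x, f4 x) := by
  induction n with
  | zero =>
    intro f1 f2 f3 f4 _ _ _ _ h
    have h0 := h default default
    simp only [sup_idem, inf_idem] at h0
    rw [Measure.volume_pi_eq_dirac (default : Fin 0 → ℝ)]
    simpa only [lintegral_dirac] using h0
  | succ n ih =>
    intro f1 f2 f3 f4 h1 h2 h3 h4 h
    have M : ∀ f : (Fin (n+1) → ℝ) → ℝ≥0∞, Measurable f →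
        Measurable (fun p : ℝ × (Fin n → ℝ) => f (Fin.cons p.1 p.2)) :=
      fun f hf => hf.comp (aux_meas_cons n)
    have M2 : ∀ f : (Fin (n+1) → ℝ) → ℝ≥0∞, Measurable f → ∀ t : ℝ,
        Measurable (fun x : Fin n → ℝ => f (Fin.cons t x)) :=
      fun f hf t => (M f hf).comp measurable_prodMk_left
    rw [aux_split n f1 h1, aux_split n f2 h2, aux_split n f3 h3, aux_split n f4 h4]
    refine aux_one_s8 _ _ _ _ (M f1 h1).lintegral_prod_right' (M f2 h2).lintegral_prod_right'
      (M f3 h3).lintegral_prod_right' (M f4 h4).lintegral_prod_right' ?_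
    intro s t
    refine ih _ _ _ _ (M2 _ h1 _) (M2 _ h2 _) (M2 _ h3 _) (M2 _ h4 _) ?_
    intro x y
    have e1 : (Fin.cons (s ⊔ t) (x ⊔ y) : Fin (n+1) → ℝ) =
        (Fin.cons s x : Fin (n+1) → ℝ) ⊔ (Fin.cons t y : Fin (n+1) → ℝ) := by
      funext i
      refine Fin.cases ?_ (fun j => ?_) i <;> simp
    have e2 : (Fin.cons (s ⊓ t) (x ⊓ y) : Fin (n+1) → ℝ) =
        (Fin.cons s x : Fin (n+1) → ℝ) ⊓ (Fin.cons t y : Fin (n+1) → ℝ) := by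
      funext i
      refine Fin.cases ?_ (fun j => ?_) i <;> simp
    rw [e1, e2]
    exact h _ _

/-- Second-order increments from a sign on the second derivative. -/
lemma aux_incr {E : Type*} [NormedAddCommGroup E] [NormedSpace ℝ E] (L : E → ℝ)
    (hL : ContDiff ℝ 2 L) (v w : E)
    (hH : ∀ p, 0 ≤ fderiv ℝ (fderiv ℝ L) p v w) (p : E) :
    L (p + w) - L p ≤ L (p + v + w) - L (p + v) := by
  have hd : Differentiable ℝ L := hL.differentiable (by norm_num)
  have hd2 : Differentiable ℝ (fderiv ℝ L) :=
    (hL.fderiv_right (m := 1) (by norm_num)).differentiable (by norm_num)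
  have line : ∀ (q a : E) (t : ℝ), HasDerivAt (fun t : ℝ => q + t • a) a t := by
    intro q a t
    simpa using ((hasDerivAt_id t).smul_const a).const_add q
  have key : ∀ q, fderiv ℝ L q w ≤ fderiv ℝ L (q + v) w := by
    intro q
    have hder : ∀ t : ℝ, HasDerivAt (fun t : ℝ => fderiv ℝ L (q + t • v) w)
        (fderiv ℝ (fderiv ℝ L) (q + t • v) v w) t := by
      intro t
      have := (hd2 (q + t • v)).hasFDerivAt.comp_hasDerivAt t (line q v t)
      simpa using this.clm_apply (hasDerivAt_const t w)
    have mono := monotone_of_hasDerivAt_nonneg hder (fun t => hH _)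
    simpa using mono (zero_le_one' ℝ)
  have hder : ∀ t : ℝ, HasDerivAt (fun t : ℝ => L (p + v + t • w) - L (p + t • w))
      (fderiv ℝ L (p + v + t • w) w - fderiv ℝ L (p + t • w) w) t := by
    intro t
    exact ((hd _).hasFDerivAt.comp_hasDerivAt t (line (p + v) w t)).sub
      ((hd _).hasFDerivAt.comp_hasDerivAt t (line p w t))
  have mono := monotone_of_hasDerivAt_nonneg hder (fun t => by
    have := key (p + t • w)
    rw [show p + t • w + v = p + v + t • w by abel] at this
    exact sub_nonneg.2 this)
  have := mono (zero_le_one' ℝ)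
  simp at this
  linarith

lemma aux_bilin (m d : ℕ)
    (H : ((Fin m → ℝ) × (Fin d → ℝ)) →L[ℝ] ((Fin m → ℝ) × (Fin d → ℝ)) →L[ℝ] ℝ)
    (h1 : ∀ j k : Fin d, j ≠ k →
      0 ≤ H ((0 : Fin m → ℝ), Pi.single k 1) ((0 : Fin m → ℝ), Pi.single j 1))
    (h2 : ∀ (l : Fin m) (j : Fin d),
      H (Pi.single l 1, (0 : Fin d → ℝ)) ((0 : Fin m → ℝ), Pi.single j 1) ≤ 0)
    (a : Fin m → ℝ) (b w : Fin d → ℝ) (ha : a ≤ 0) (hb : 0 ≤ b) (hw : 0 ≤ w)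
    (hbw : ∀ j, b j * w j = 0) : 0 ≤ H (a, b) (0, w) := by
  have ew : ∀ w : Fin d → ℝ, ((0 : Fin m → ℝ), w) =
      ∑ j, w j • ((0 : Fin m → ℝ), (Pi.single j 1 : Fin d → ℝ)) := by
    intro w
    ext i
    · simp [Prod.fst_sum]
    · simp [Prod.snd_sum, Finset.sum_apply, Pi.single_apply]
  have ea : (a, (0 : Fin d → ℝ)) =
      ∑ l, a l • ((Pi.single l 1 : Fin m → ℝ), (0 : Fin d → ℝ)) := by
    ext i
    · simp [Prod.fst_sum, Finset.sum_apply, Pi.single_apply]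
    · simp [Prod.snd_sum]
  have eab : (a, b) = (a, (0 : Fin d → ℝ)) + ((0 : Fin m → ℝ), b) := by simp
  rw [eab, map_add, ContinuousLinearMap.add_apply, ea, ew b, ew w]
  simp only [map_sum, map_smul, ContinuousLinearMap.sum_apply, ContinuousLinearMap.smul_apply,
    smul_eq_mul]
  apply add_nonneg
  · refine Finset.sum_nonneg fun j _ => ?_
    try rw [Finset.mul_sum]
    refine Finset.sum_nonneg fun l _ => ?_
    have t1 := h2
    have t2 := ha
    have t3 := hw
    first
      | exact mul_nonneg (hw j) (mul_nonneg_of_nonpos_of_nonpos (ha l) (h2 l j))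
      | exact mul_nonneg (hw l) (mul_nonneg_of_nonpos_of_nonpos (ha j) (h2 j l))
  · refine Finset.sum_nonneg fun j _ => ?_
    try rw [Finset.mul_sum]
    refine Finset.sum_nonneg fun k _ => ?_
    by_cases hjk : j = k
    · subst hjk
      rw [← mul_assoc]
      first
        | rw [hbw j, zero_mul]
        | rw [mul_comm (w j), hbw j, zero_mul]
    · first
        | exact mul_nonneg (hw j) (mul_nonneg (hb k) (h1 j k hjk))
        | exact mul_nonneg (hw k) (mul_nonneg (hb j) (h1 k j (Ne.symm hjk)))

/-- The Z-shift link (Equation (15)) in the proof of Proposition 4: if `log h` is C² with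
nonnegative within-`u` cross partials and nonpositive across-`z`-`u` cross partials, then
for `z' ≤ z` the normalized density `h (z', ·)` stochastically dominates `h (z, ·)`. -/
theorem stmt8 (m d : ℕ) (hm : 1 ≤ m) (hd : 1 ≤ d)
    (h : (Fin m → ℝ) × (Fin d → ℝ) → ℝ)
    (hpos : ∀ p, 0 < h p)
    (hsmooth : ContDiff ℝ 2 (fun p => Real.log (h p)))
    (hcross_uu : ∀ j k : Fin d, j ≠ k → ∀ p : (Fin m → ℝ) × (Fin d → ℝ),
      0 ≤ fderiv ℝ (fun q => fderiv ℝ (fun r => Real.log (h r)) q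
            ((0 : Fin m → ℝ), Pi.single j 1)) p ((0 : Fin m → ℝ), Pi.single k 1))
    (hcross_zu : ∀ (l : Fin m) (j : Fin d), ∀ p : (Fin m → ℝ) × (Fin d → ℝ),
      fderiv ℝ (fun q => fderiv ℝ (fun r => Real.log (h r)) q
            ((0 : Fin m → ℝ), Pi.single j 1)) p (Pi.single l 1, (0 : Fin d → ℝ)) ≤ 0)
    (hint : ∀ z : Fin m → ℝ, Integrable (fun u => h (z, u)))
    (hint_pos : ∀ z : Fin m → ℝ, 0 < ∫ u, h (z, u))
    (z' z : Fin m → ℝ) (hz : z' ≤ z)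
    (φ : (Fin d → ℝ) → ℝ) (hφ_meas : Measurable φ) (hφ_mono : Monotone φ)
    (hφ_bdd : ∃ C, ∀ u, |φ u| ≤ C) :
    ∫ u, φ u * (h (z, u) / ∫ v, h (z, v)) ≤ ∫ u, φ u * (h (z', u) / ∫ v, h (z', v)) := by
  obtain ⟨C, hC⟩ := hφ_bdd
  set L : (Fin m → ℝ) × (Fin d → ℝ) → ℝ := fun r => Real.log (h r) with hLdef
  have hd2 : Differentiable ℝ (fderiv ℝ L) :=
    (hsmooth.fderiv_right (m := 1) (by norm_num)).differentiable (by norm_num)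
  have hsecond : ∀ (a b p : (Fin m → ℝ) × (Fin d → ℝ)),
      fderiv ℝ (fun q => fderiv ℝ L q a) p b = fderiv ℝ (fderiv ℝ L) p b a := by
    intro a b p
    rw [fderiv_clm_apply (hd2 p) (differentiableAt_const a)]
    simp
  have hlat : ∀ x y, h (z, x) * h (z', y) ≤ h (z', x ⊔ y) * h (z, x ⊓ y) := by
    intro x y
    have := aux_incr L hsmooth (z' - z, y - x ⊓ y) (0, x - x ⊓ y) (fun p => by
      refine aux_bilin m d _ (fun j k hjk => ?_) (fun l j => ?_) _ _ _ ?_ ?_ ?_ ?_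
      · rw [← hsecond]; exact hcross_uu j k hjk p
      · rw [← hsecond]; exact hcross_zu l j p
      · exact sub_nonpos.2 hz
      · exact sub_nonneg.2 inf_le_right
      · exact sub_nonneg.2 inf_le_left
      · intro j
        rcases le_total (x j) (y j) with hh | hh <;> simp [hh]) (z, x ⊓ y)
    have e1 : (z, x ⊓ y) + ((0 : Fin m → ℝ), x - x ⊓ y) = (z, x) := by simp
    have e2 : (z, x ⊓ y) + (z' - z, y - x ⊓ y) = (z', y) := by simp
    have e3 : (z', y) + ((0 : Fin m → ℝ), x - x ⊓ y) = (z', x ⊔ y) := by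
      have : y + (x - x ⊓ y) = x ⊔ y := by
        funext j
        rcases le_total (x j) (y j) with hh | hh <;> simp [hh]
      simp [this]
    rw [e2, e1, e3] at this
    have h4 : Real.log (h (z, x) * h (z', y)) ≤ Real.log (h (z', x ⊔ y) * h (z, x ⊓ y)) := by
      rw [Real.log_mul (hpos _).ne' (hpos _).ne', Real.log_mul (hpos _).ne' (hpos _).ne']
      simp only [hLdef] at this
      linarith
    exact (Real.log_le_log_iff (mul_pos (hpos _) (hpos _)) (mul_pos (hpos _) (hpos _))).1 h4
  have hcont : Continuous h := by
    have : h = fun p => Real.exp (L p) := by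
      funext p; simp [hLdef, Real.exp_log (hpos p)]
    rw [this]
    exact Real.continuous_exp.comp hsmooth.continuous
  have hmz : ∀ z, Measurable (fun u => h (z, u)) := fun z =>
    (hcont.comp (by fun_prop : Continuous fun u : Fin d → ℝ => (z, u))).measurable
  have hψ0 : ∀ u, 0 ≤ φ u + C := fun u => by linarith [neg_le_of_abs_le (hC u)]
  have hφi : ∀ z, Integrable (fun u => φ u * h (z, u)) := fun z =>
    (hint z).bdd_mul (c := C) hφ_meas.aestronglyMeasurable (Filter.Eventually.of_forall hC)
  have hψi : ∀ z, Integrable (fun u => (φ u + C) * h (z, u)) := fun z => by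
    simp only [add_mul]
    exact (hφi z).add ((hint z).const_mul C)
  have hψm : ∀ z, Measurable (fun u => (φ u + C) * h (z, u)) := fun z =>
    (hφ_meas.add_const C).mul (hmz z)
  have hψn : ∀ z u, 0 ≤ (φ u + C) * h (z, u) := fun z u => mul_nonneg (hψ0 u) (hpos _).le
  have main := aux_four_s8 d (fun u => ENNReal.ofReal ((φ u + C) * h (z, u)))
    (fun u => ENNReal.ofReal (h (z', u))) (fun u => ENNReal.ofReal ((φ u + C) * h (z', u)))
    (fun u => ENNReal.ofReal (h (z, u))) (hψm z).ennreal_ofReal (hmz z').ennreal_ofReal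
    (hψm z').ennreal_ofReal (hmz z).ennreal_ofReal (fun x y => by
      rw [← ENNReal.ofReal_mul (hψn _ _), ← ENNReal.ofReal_mul (hψn _ _)]
      apply ENNReal.ofReal_le_ofReal
      rw [mul_assoc, mul_assoc]
      exact mul_le_mul (by linarith [hφ_mono (le_sup_left : x ≤ x ⊔ y)]) (hlat x y)
        (mul_pos (hpos _) (hpos _)).le (hψ0 _))
  rw [← ofReal_integral_eq_lintegral_ofReal (hψi z) (Filter.Eventually.of_forall (hψn z)),
    ← ofReal_integral_eq_lintegral_ofReal (hψi z') (Filter.Eventually.of_forall (hψn z')),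
    ← ofReal_integral_eq_lintegral_ofReal (hint z) (Filter.Eventually.of_forall fun u => (hpos _).le),
    ← ofReal_integral_eq_lintegral_ofReal (hint z') (Filter.Eventually.of_forall fun u => (hpos _).le),
    ← ENNReal.ofReal_mul (integral_nonneg (hψn z)), ← ENNReal.ofReal_mul (integral_nonneg (hψn z')),
    ENNReal.ofReal_le_ofReal_iff (mul_nonneg (integral_nonneg (hψn z')) (hint_pos z).le)] at main
  have hexp : ∀ z, ∫ u, (φ u + C) * h (z, u) = (∫ u, φ u * h (z, u)) + C * ∫ u, h (z, u) := by
    intro z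
    simp only [add_mul]
    rw [integral_add (hφi z) ((hint z).const_mul C), integral_const_mul]
  rw [hexp, hexp] at main
  simp only [← mul_div_assoc, integral_div]
  rw [div_le_div_iff₀ (hint_pos z) (hint_pos z')]
  linarith
end

section
/- (Z-dominance, Proposition 4) Let m, d ≥ 1. For each z ∈ ℝᵐ let g(· | z) : ℝᵈ → ℝ be a probability density with respect to Lebesgue measure that is log-supermodular in u (g(u | z) g(u' | z) ≤ g(u ⊓ u' | z) g(u ⊔ u' | z) for all u, u'), and let π : ℝᵐ × ℝᵈ → ℝ be measurable with 0 ≤ π ≤ 1 and u ↦ π(z, u) coordinatewise nondecreasing for every z; assume 0 < ∫ π(z, u) g(u | z) du < 1 for every z. For x ∈ {0, 1} define h⁽ˣ⁾(z, u) := π(z, u)ˣ (1 − π(z, u))¹⁻ˣ g(u | z), and assume that for some x ∈ {0, 1}, h⁽ˣ⁾ is strictly positive with log h⁽ˣ⁾ twice continuously differentiable satisfying ∂² log h⁽ˣ⁾ / ∂u⁽ʲ⁾∂u⁽ᵏ⁾ ≥ 0 for all j ≠ k and ∂² log h⁽ˣ⁾ / ∂z⁽ˡ⁾∂u⁽ʲ⁾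 ≤ 0 for all l, j, everywhere. Then for all z', z ∈ ℝᵐ with z' ≤ z coordinatewise, the probability measure with density u ↦ π(z', u) g(u | z') / ∫ π(z', v) g(v | z') dv stochastically dominates the probability measure with density u ↦ (1 − π(z, u)) g(u | z) / ∫ (1 − π(z, v)) g(v | z) dv. -/
open MeasureTheory

/-- The function `h⁽ˣ⁾(z, u) = π(z,u)ˣ (1 − π(z,u))¹⁻ˣ g(u|z)` of Proposition 4,
indexed by `x : Bool` (`true` ↔ x = 1, `false` ↔ x = 0). -/
noncomputable def hFun {m d : ℕ} (π g : (Fin m → ℝ) → (Fin d → ℝ) → ℝ) (x : Bool)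
    (p : (Fin m → ℝ) × (Fin d → ℝ)) : ℝ :=
  (if x then π p.1 p.2 else 1 - π p.1 p.2) * g p.1 p.2

namespace ZDom
open scoped ENNReal

lemma ennreal_two (a b A B : ℝ≥0∞) (ha : a ≤ A) (hb : b ≤ A) (hab : a * b ≤ A * B) :
    a + b ≤ A + B := by
  by_cases hA : A = ⊤
  · simp [hA]
  by_cases hB : B = ⊤
  · simp [hB]
  have ha' : a ≠ ⊤ := ne_top_of_le_ne_top hA ha
  have hb' : b ≠ ⊤ := ne_top_of_le_ne_top hA hb
  lift A to NNReal using hA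
  lift B to NNReal using hB
  lift a to NNReal using ha'
  lift b to NNReal using hb'
  norm_cast at *
  rw [← NNReal.coe_le_coe] at *
  push_cast at *
  have h1 := a.coe_nonneg
  have h2 := b.coe_nonneg
  have h4 := B.coe_nonneg
  rcases A.coe_nonneg.eq_or_lt with h | h
  · linarith
  · have h3 := mul_nonneg (sub_nonneg.2 ha) (sub_nonneg.2 hb)
    have : (A:ℝ) * (a + b) ≤ A * (A + B) := by nlinarith
    exact le_of_mul_le_mul_left this h

lemma four_one (f1 f2 f3 f4 : ℝ → ℝ≥0∞) (h1 : Measurable f1) (h2 : Measurable f2)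
    (h3 : Measurable f3) (h4 : Measurable f4)
    (h : ∀ x y, f1 x * f2 y ≤ f3 (x ⊓ y) * f4 (x ⊔ y)) :
    (∫⁻ x, f1 x) * (∫⁻ x, f2 x) ≤ (∫⁻ x, f3 x) * (∫⁻ x, f4 x) := by
  have key : ∀ x y, x ≤ y → f1 x * f2 y + f1 y * f2 x ≤ f3 x * f4 y + f3 y * f4 x := by
    intro x y hxy
    apply ennreal_two
    · simpa [hxy] using h x y
    · simpa [hxy] using h y x
    · have e1 := h x x
      have e2 := h y y
      simp only [inf_idem, sup_idem] at e1 e2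
      calc f1 x * f2 y * (f1 y * f2 x) = (f1 x * f2 x) * (f1 y * f2 y) := by ring
        _ ≤ (f3 x * f4 x) * (f3 y * f4 y) := mul_le_mul' e1 e2
        _ = _ := by ring
  have key2 : ∀ x y, f1 x * f2 y + f1 y * f2 x ≤ f3 x * f4 y + f3 y * f4 x := by
    intro x y
    rcases le_total x y with hxy | hxy
    · exact key x y hxy
    · have := key y x hxy
      rw [add_comm (f1 x * f2 y), add_comm (f3 x * f4 y)]
      exact this
  have expand : ∀ p q : ℝ → ℝ≥0∞, Measurable p → Measurable q →
      ∫⁻ x, ∫⁻ y, (p x * q y + p y * q x) = 2 * ((∫⁻ x, p x) * ∫⁻ x, q x) := by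
    intro p q hp hq
    have : ∀ x, ∫⁻ y, (p x * q y + p y * q x) = p x * (∫⁻ y, q y) + (∫⁻ y, p y) * q x := by
      intro x
      rw [lintegral_add_left (hq.const_mul _), lintegral_const_mul _ hq, lintegral_mul_const _ hp]
    simp_rw [this]
    rw [lintegral_add_left (hp.mul_const _), lintegral_const_mul _ hq, lintegral_mul_const _ hp]
    ring
  have : 2 * ((∫⁻ x, f1 x) * (∫⁻ x, f2 x)) ≤ 2 * ((∫⁻ x, f3 x) * (∫⁻ x, f4 x)) := by
    rw [← expand f1 f2 h1 h2, ← expand f3 f4 h3 h4]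
    exact lintegral_mono fun x => lintegral_mono fun y => key2 x y
  exact (ENNReal.mul_le_mul_iff_right (by simp) (by simp)).1 this

lemma lintegral_cons {d : ℕ} (f : (Fin (d+1) → ℝ) → ℝ≥0∞) (hf : Measurable f) :
    ∫⁻ u, f u = ∫⁻ v : Fin d → ℝ, ∫⁻ x : ℝ, f (Fin.cons x v) := by
  have e := (volume_preserving_piFinSuccAbove (fun _ : Fin (d+1) => ℝ) 0).symm
  rw [← e.lintegral_comp hf]
  have hm : Measurable fun a => f ((MeasurableEquiv.piFinSuccAbove (fun _ : Fin (d+1) => ℝ) 0).symm a) :=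
    hf.comp (MeasurableEquiv.measurable _)
  erw [lintegral_prod_symm' _ hm]
  refine lintegral_congr fun v => lintegral_congr fun x => ?_
  congr 1
  funext i
  refine Fin.cases ?_ (fun j => ?_) i <;> simp [MeasurableEquiv.piFinSuccAbove]

lemma meas_cons {d : ℕ} : Measurable fun p : (Fin d → ℝ) × ℝ => (Fin.cons p.2 p.1 : Fin (d+1) → ℝ) := by
  refine measurable_pi_iff.2 fun i => ?_
  refine Fin.cases ?_ (fun j => ?_) i
  · simpa using measurable_snd
  · exact (measurable_pi_apply j).comp measurable_fst

lemma four_d (d : ℕ) : ∀ (f1 f2 f3 f4 : (Fin d → ℝ) → ℝ≥0∞) (_ : Measurable f1) (_ : Measurable f2)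
    (_ : Measurable f3) (_ : Measurable f4)
    (_ : ∀ x y, f1 x * f2 y ≤ f3 (x ⊓ y) * f4 (x ⊔ y)),
    (∫⁻ x, f1 x) * (∫⁻ x, f2 x) ≤ (∫⁻ x, f3 x) * (∫⁻ x, f4 x) := by
  induction d with
  | zero =>
    intro f1 f2 f3 f4 _ _ _ _ h
    simp only [volume_pi, Measure.pi_of_empty (x := (0 : Fin 0 → ℝ)), lintegral_dirac]
    have := h 0 0
    simpa using this
  | succ d ih =>
    intro f1 f2 f3 f4 h1 h2 h3 h4 h
    rw [lintegral_cons f1 h1, lintegral_cons f2 h2, lintegral_cons f3 h3, lintegral_cons f4 h4]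
    have M : ∀ f : (Fin (d+1) → ℝ) → ℝ≥0∞, Measurable f →
        Measurable fun v : Fin d → ℝ => ∫⁻ x : ℝ, f (Fin.cons x v) := fun f hf =>
      (hf.comp meas_cons).lintegral_prod_right'
    have M1 : ∀ f : (Fin (d+1) → ℝ) → ℝ≥0∞, Measurable f → ∀ v : Fin d → ℝ,
        Measurable fun x : ℝ => f (Fin.cons x v) := fun f hf v =>
      (hf.comp meas_cons).comp (measurable_const.prodMk measurable_id)
    refine ih _ _ _ _ (M _ h1) (M _ h2) (M _ h3) (M _ h4) fun u v => ?_
    refine four_one _ _ _ _ (M1 _ h1 _) (M1 _ h2 _) (M1 _ h3 _) (M1 _ h4 _) fun x y => ?_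
    have e1 : (Fin.cons (x ⊓ y) (u ⊓ v) : Fin (d+1) → ℝ) = Fin.cons x u ⊓ Fin.cons y v := by
      funext i
      refine Fin.cases ?_ (fun j => ?_) i <;> simp
    have e2 : (Fin.cons (x ⊔ y) (u ⊔ v) : Fin (d+1) → ℝ) = Fin.cons x u ⊔ Fin.cons y v := by
      funext i
      refine Fin.cases ?_ (fun j => ?_) i <;> simp
    rw [e1, e2]
    exact h _ _

lemma holley {d : ℕ} (p q φ : (Fin d → ℝ) → ℝ) (hp : ∀ u, 0 ≤ p u) (hq : ∀ u, 0 ≤ q u)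
    (mp : Measurable p) (mq : Measurable q) (ip : Integrable p) (iq : Integrable q)
    (hp0 : 0 < ∫ u, p u) (hq0 : 0 < ∫ u, q u)
    (h : ∀ u v, p u * q v ≤ q (u ⊓ v) * p (u ⊔ v))
    (mφ : Measurable φ) (monφ : Monotone φ) (bφ : ∃ C, ∀ u, |φ u| ≤ C) :
    ∫ u, φ u * (q u / ∫ v, q v) ≤ ∫ u, φ u * (p u / ∫ v, p v) := by
  obtain ⟨C, hC⟩ := bφ
  have hψ : ∀ u, 0 ≤ φ u + C := fun u => by linarith [neg_le_of_abs_le (hC u)]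
  have iφ : ∀ r : (Fin d → ℝ) → ℝ, Integrable r → Integrable fun u => φ u * r u := fun r ir =>
    ir.bdd_mul mφ.aestronglyMeasurable (c := C) (Filter.Eventually.of_forall fun u => by simpa using hC u)
  have iψ : ∀ r : (Fin d → ℝ) → ℝ, Integrable r → Integrable fun u => (φ u + C) * r u := fun r ir => by
    simp_rw [add_mul]
    exact (iφ r ir).add (ir.const_mul C)
  have hE : ∀ r : (Fin d → ℝ) → ℝ, Integrable r →
      ∫ u, (φ u + C) * r u = (∫ u, φ u * r u) + C * ∫ u, r u := fun r ir => by
    simp_rw [add_mul]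
    rw [integral_add (iφ r ir) (ir.const_mul C), integral_const_mul]
  have hconv : ∀ r : (Fin d → ℝ) → ℝ, Integrable r → (∀ u, 0 ≤ r u) →
      ENNReal.ofReal (∫ u, r u) = ∫⁻ u, ENNReal.ofReal (r u) := fun r ir hr =>
    ofReal_integral_eq_lintegral_ofReal ir (Filter.Eventually.of_forall hr)
  have hψp : ∀ u, 0 ≤ (φ u + C) * p u := fun u => mul_nonneg (hψ u) (hp u)
  have hψq : ∀ u, 0 ≤ (φ u + C) * q u := fun u => mul_nonneg (hψ u) (hq u)
  have main : (∫ u, p u) * (∫ u, (φ u + C) * q u) ≤ (∫ u, q u) * (∫ u, (φ u + C) * p u) := by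
    rw [← ENNReal.ofReal_le_ofReal_iff (mul_nonneg hq0.le (integral_nonneg hψp)),
      ENNReal.ofReal_mul hp0.le, ENNReal.ofReal_mul hq0.le,
      hconv _ ip hp, hconv _ iq hq, hconv _ (iψ p ip) hψp, hconv _ (iψ q iq) hψq]
    refine four_d d _ _ _ _ mp.ennreal_ofReal ((mφ.add_const C).mul mq).ennreal_ofReal mq.ennreal_ofReal
      ((mφ.add_const C).mul mp).ennreal_ofReal fun u v => ?_
    rw [← ENNReal.ofReal_mul (hp u), ← ENNReal.ofReal_mul (hq _)]
    apply ENNReal.ofReal_le_ofReal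
    have h1 : φ v ≤ φ (u ⊔ v) := monφ le_sup_right
    calc p u * ((φ v + C) * q v) = (φ v + C) * (p u * q v) := by ring
      _ ≤ (φ (u ⊔ v) + C) * (q (u ⊓ v) * p (u ⊔ v)) :=
        mul_le_mul (by linarith) (h u v) (mul_nonneg (hp u) (hq v)) (hψ _)
      _ = _ := by ring
  rw [hE p ip, hE q iq] at main
  simp_rw [← mul_div_assoc]
  rw [integral_div, integral_div, div_le_div_iff₀ hq0 hp0]
  nlinarith

lemma mono_dir {E : Type*} [NormedAddCommGroup E] [NormedSpace ℝ E] (F : E → ℝ)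
    (hF : Differentiable ℝ F) (e : E) (h : ∀ p, 0 ≤ fderiv ℝ F p e) (p : E) :
    F p ≤ F (p + e) := by
  have hd : ∀ t : ℝ, HasDerivAt (fun t : ℝ => F (p + t • e)) (fderiv ℝ F (p + t • e) e) t := by
    intro t
    have h1 : HasDerivAt (fun t : ℝ => p + t • e) e t := by
      simpa using ((hasDerivAt_id t).smul_const e).const_add p
    exact (hF _).hasFDerivAt.comp_hasDerivAt t h1
  have hm : Monotone fun t : ℝ => F (p + t • e) :=
    monotone_of_deriv_nonneg (fun t => (hd t).differentiableAt) fun t => by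
      rw [(hd t).deriv]; exact h _
  simpa using hm zero_le_one

lemma superm {E : Type*} [NormedAddCommGroup E] [NormedSpace ℝ E] (L : E → ℝ)
    (hL : ContDiff ℝ 2 L) (e w : E)
    (h : ∀ p, 0 ≤ fderiv ℝ (fderiv ℝ L) p e w) (p : E) :
    L (p + e) + L (p + w) ≤ L p + L (p + e + w) := by
  have hL1 : Differentiable ℝ L := hL.differentiable (by norm_num)
  have hL2 : Differentiable ℝ (fderiv ℝ L) :=
    (hL.fderiv_right (m := 1) (by norm_num)).differentiable (by norm_num)
  have hk : ∀ q, fderiv ℝ L q w ≤ fderiv ℝ L (q + e) w := by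
    intro q
    refine mono_dir (fun q => fderiv ℝ L q w) (fun q => (hL2 q).clm_apply (differentiableAt_const _)) e (fun p => ?_) q
    rw [fderiv_clm_apply (hL2 p) (differentiableAt_const _)]
    simpa using h p
  have hLe : Differentiable ℝ fun q => L (q + e) := hL1.comp (differentiable_id.add_const e)
  have := mono_dir (fun q => L (q + e) - L q) (hLe.sub hL1) w (fun q => by
      rw [fderiv_fun_sub (hLe q) (hL1 q), fderiv_comp_add_right]
      simpa using hk q) p
  rw [show p + e + w = p + w + e by abel]
  linarith

lemma logsm {m d : ℕ} (L : (Fin m → ℝ) × (Fin d → ℝ) → ℝ) (hL : ContDiff ℝ 2 L)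
    (h1 : ∀ j k : Fin d, j ≠ k → ∀ p : (Fin m → ℝ) × (Fin d → ℝ),
        0 ≤ fderiv ℝ (fun q => fderiv ℝ L q
              ((0 : Fin m → ℝ), Pi.single j 1)) p ((0 : Fin m → ℝ), Pi.single k 1))
    (h2 : ∀ (l : Fin m) (j : Fin d), ∀ p : (Fin m → ℝ) × (Fin d → ℝ),
        fderiv ℝ (fun q => fderiv ℝ L q
              ((0 : Fin m → ℝ), Pi.single j 1)) p (Pi.single l 1, (0 : Fin d → ℝ)) ≤ 0)
    (z' z : Fin m → ℝ) (hz : z' ≤ z) (u v : Fin d → ℝ) :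
    L (z', u) + L (z, v) ≤ L (z, u ⊓ v) + L (z', u ⊔ v) := by
  have hL2 : Differentiable ℝ (fderiv ℝ L) :=
    (hL.fderiv_right (m := 1) (by norm_num)).differentiable (by norm_num)
  have hB : ∀ p (e w : (Fin m → ℝ) × (Fin d → ℝ)),
      fderiv ℝ (fun q => fderiv ℝ L q w) p e = fderiv ℝ (fderiv ℝ L) p e w := by
    intro p e w
    rw [fderiv_clm_apply (hL2 p) (differentiableAt_const _)]
    simp
  simp only [hB] at h1 h2
  have dec0 : ∀ t : Fin d → ℝ, ((0 : Fin m → ℝ), t) = ∑ j, t j • ((0 : Fin m → ℝ), (Pi.single j 1 : Fin d → ℝ)) := by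
    intro t
    ext i
    · simp [Prod.fst_sum]
    · simp [Prod.snd_sum, Finset.sum_apply, Pi.single_apply]
  have dec1 : ∀ t : Fin m → ℝ, (t, (0 : Fin d → ℝ)) = ∑ j, t j • ((Pi.single j 1 : Fin m → ℝ), (0 : Fin d → ℝ)) := by
    intro t
    ext i
    · simp [Prod.fst_sum, Finset.sum_apply, Pi.single_apply]
    · simp [Prod.snd_sum]
  have := superm L hL (z' - z, u - u ⊓ v) (0, v - u ⊓ v) (fun p => by
    have hs : ((z' - z, u - u ⊓ v) : (Fin m → ℝ) × (Fin d → ℝ)) = (z' - z, 0) + (0, u - u ⊓ v) := by simp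
    rw [hs, dec0 (v - u ⊓ v), dec0 (u - u ⊓ v), dec1 (z' - z)]
    simp only [map_add, map_sum, map_smul, add_apply,
      sum_apply, smul_apply, smul_eq_mul]
    refine Finset.sum_nonneg fun j _ => ?_
    rw [mul_add]
    refine add_nonneg (mul_nonneg (by simp) ?_) ?_
    · refine Finset.sum_nonneg fun l _ => mul_nonneg_of_nonpos_of_nonpos ?_ (h2 l j p)
      have := hz l
      simp only [Pi.sub_apply]
      linarith
    · rw [Finset.mul_sum]
      refine Finset.sum_nonneg fun k _ => ?_
      by_cases hjk : j = k
      · subst hjk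
        rcases le_total (u j) (v j) with hle | hle <;> simp [hle]
      · exact mul_nonneg (by simp) (mul_nonneg (by simp) (h1 j k hjk p))) (z, u ⊓ v)
  have e1 : ((z, u ⊓ v) + (z' - z, u - u ⊓ v) : (Fin m → ℝ) × (Fin d → ℝ)) = (z', u) := by simp
  have e2 : ((z, u ⊓ v) + (0, v - u ⊓ v) : (Fin m → ℝ) × (Fin d → ℝ)) = (z, v) := by simp
  have e3 : ((z', u) + (0, v - u ⊓ v) : (Fin m → ℝ) × (Fin d → ℝ)) = (z', u ⊔ v) := by
    ext i
    · simp
    · have := min_add_max (u i) (v i)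
      simp
      linarith
  rwa [e1, e2, e3] at this

end ZDom

/-- Proposition 4 (Z-dominance, multivariate U): under monotonicity of the propensity in `u`,
log-supermodularity of the prior `g(·|z)`, and the cross-derivative conditions on
`log h⁽ˣ⁾` for some treatment arm `x`, the posterior `P(U | Z = z', X = 1)` stochastically
dominates `P(U | Z = z, X = 0)` whenever `z' ≤ z` coordinatewise. -/
theorem stmt9 (m d : ℕ) (hm : 1 ≤ m) (hd : 1 ≤ d)
    (g : (Fin m → ℝ) → (Fin d → ℝ) → ℝ)
    (hg_nn : ∀ z u, 0 ≤ g z u) (hg_meas : ∀ z, Measurable (g z))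
    (hg_int : ∀ z, ∫ u, g z u = 1)
    (hg_lsm : ∀ z, ∀ u u' : Fin d → ℝ, g z u * g z u' ≤ g z (u ⊓ u') * g z (u ⊔ u'))
    (π : (Fin m → ℝ) → (Fin d → ℝ) → ℝ)
    (hπ_meas : Measurable (fun p : (Fin m → ℝ) × (Fin d → ℝ) => π p.1 p.2))
    (hπ01 : ∀ z u, 0 ≤ π z u ∧ π z u ≤ 1)
    (hπ_mono : ∀ z, Monotone (π z))
    (hc : ∀ z, 0 < (∫ u, π z u * g z u) ∧ (∫ u, π z u * g z u) < 1)
    (hx : ∃ x : Bool,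
      (∀ p, 0 < hFun π g x p) ∧
      ContDiff ℝ 2 (fun p => Real.log (hFun π g x p)) ∧
      (∀ j k : Fin d, j ≠ k → ∀ p : (Fin m → ℝ) × (Fin d → ℝ),
        0 ≤ fderiv ℝ (fun q => fderiv ℝ (fun r => Real.log (hFun π g x r)) q
              ((0 : Fin m → ℝ), Pi.single j 1)) p ((0 : Fin m → ℝ), Pi.single k 1)) ∧
      (∀ (l : Fin m) (j : Fin d), ∀ p : (Fin m → ℝ) × (Fin d → ℝ),
        fderiv ℝ (fun q => fderiv ℝ (fun r => Real.log (hFun π g x r)) q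
              ((0 : Fin m → ℝ), Pi.single j 1)) p (Pi.single l 1, (0 : Fin d → ℝ)) ≤ 0))
    (z' z : Fin m → ℝ) (hz : z' ≤ z)
    (φ : (Fin d → ℝ) → ℝ) (hφ_meas : Measurable φ) (hφ_mono : Monotone φ)
    (hφ_bdd : ∃ C, ∀ u, |φ u| ≤ C) :
    ∫ u, φ u * ((1 - π z u) * g z u / ∫ v, (1 - π z v) * g z v)
      ≤ ∫ u, φ u * (π z' u * g z' u / ∫ v, π z' v * g z' v) := by
  have ig : ∀ z, Integrable (g z) := fun z => by
    by_contra hcon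
    have := hg_int z
    rw [integral_undef hcon] at this
    norm_num at this
  have mπ : ∀ z, Measurable (π z) := fun z => hπ_meas.comp (measurable_const.prodMk measurable_id)
  have ip : ∀ z, Integrable fun u => π z u * g z u := fun z =>
    (ig z).bdd_mul (mπ z).aestronglyMeasurable (c := 1) (Filter.Eventually.of_forall fun u => by
      rw [Real.norm_eq_abs, abs_of_nonneg (hπ01 z u).1]; exact (hπ01 z u).2)
  have iq : ∀ z, Integrable fun u => (1 - π z u) * g z u := fun z => by
    simp_rw [sub_mul, one_mul]
    exact (ig z).sub (ip z)
  have hq0 : 0 < ∫ u, (1 - π z u) * g z u := by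
    simp_rw [sub_mul, one_mul]
    rw [integral_sub (ig z) (ip z), hg_int]
    linarith [(hc z).2]
  have hπ' : ∀ z u, 0 ≤ 1 - π z u := fun z u => by linarith [(hπ01 z u).2]
  refine ZDom.holley _ _ φ (fun u => mul_nonneg (hπ01 z' u).1 (hg_nn z' u))
    (fun u => mul_nonneg (hπ' z u) (hg_nn z u)) ((mπ z').mul (hg_meas z'))
    (((mπ z).const_sub 1).mul (hg_meas z)) (ip z') (iq z) (hc z').1 hq0 (fun u v => ?_)
    hφ_meas hφ_mono hφ_bdd
  obtain ⟨x, hpos, hcd, hjk, hlj⟩ := hx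
  have hl := ZDom.logsm _ hcd hjk hlj z' z hz u v
  have hmul : hFun π g x (z', u) * hFun π g x (z, v) ≤
      hFun π g x (z, u ⊓ v) * hFun π g x (z', u ⊔ v) := by
    rw [← Real.log_mul (hpos _).ne' (hpos _).ne', ← Real.log_mul (hpos _).ne' (hpos _).ne'] at hl
    exact (Real.log_le_log_iff (mul_pos (hpos _) (hpos _)) (mul_pos (hpos _) (hpos _))).1 hl
  cases x with
  | true =>
    simp only [hFun, if_true] at hmul hpos
    have hπp : ∀ z u, 0 < π z u := fun z u =>
      (hπ01 z u).1.lt_of_ne fun h0 => by have := hpos (z, u); simp [← h0] at this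
    have hm1 : π z (u ⊓ v) ≤ π z v := hπ_mono z inf_le_right
    have hr : (1 - π z v) / π z v ≤ (1 - π z (u ⊓ v)) / π z (u ⊓ v) :=
      div_le_div₀ (hπ' _ _) (by linarith) (hπp _ _) hm1
    have := mul_le_mul hr hmul (mul_pos (hpos (z', u)) (hpos (z, v))).le (div_nonneg (hπ' _ _) (hπp _ _).le)
    have a1 := (hπp z v).ne'
    have a2 := (hπp z (u ⊓ v)).ne'
    refine le_of_eq_of_le ?_ (this.trans_eq ?_)
    · beta_reduce
      field_simp
    · beta_reduce
      field_simp
  | false =>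
    simp only [hFun] at hmul hpos
    simp only [Bool.false_eq_true, if_false] at hmul hpos
    have hπp : ∀ z u, 0 < 1 - π z u := fun z u =>
      (hπ' z u).lt_of_ne fun h0 => by have := hpos (z, u); simp [← h0] at this
    have hm1 : π z' u ≤ π z' (u ⊔ v) := hπ_mono z' le_sup_left
    have hr : π z' u / (1 - π z' u) ≤ π z' (u ⊔ v) / (1 - π z' (u ⊔ v)) :=
      div_le_div₀ (hπ01 _ _).1 hm1 (hπp _ _) (by linarith)
    have := mul_le_mul hr hmul (mul_pos (hpos (z', u)) (hpos (z, v))).le (div_nonneg (hπ01 _ _).1 (hπp _ _).le)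
    have a1 := (hπp z' u).ne'
    have a2 := (hπp z' (u ⊔ v)).ne'
    refine le_of_eq_of_le ?_ (this.trans_eq ?_)
    · beta_reduce
      field_simp
    · beta_reduce
      field_simp
end

section
/- Consider the model: Z ∈ {0,1} with P(Z = 0) = P(Z = 1) = 1/2, U uniform on [0,1] independent of Z, and propensity π(Z, U) defined by π(0, u) = u for all u, π(1, u) = u for u < 1/2, and π(1, u) = 1 for u ≥ 1/2 (so π is nondecreasing in u for each z and nondecreasing in z for each u). Then the Bayes posteriors satisfy: P(U > 1/2 | Z = 1, X = 1) = 0.8, P(U > 1/2 | Z = 0, X = 1) = 0.75, P(U > 1/2 | Z = 1, X = 0) = 0, and P(U > 1/2 | Z = 0, X = 0) = 0.25. In particular, the X = 1 chain of Proposition 4 fails at this pair (0.75 < 0.8, i.e., P(U | Z = 0, X = 1) does not stochastically dominate P(U | Z = 1, X = 1)), while the two-step dominance P(U > 1/2 | Z = 0, X = 1) ≥ P(U > 1/2 | Z = 1, X = 0) still holds via the X = 0 chain. -/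
open MeasureTheory intervalIntegral

/-- The propensity `π(z, u)` of Example 6: `π(0, u) = u`; `π(1, u) = u` for `u < 1/2`
and `π(1, u) = 1` for `u ≥ 1/2`. It is nondecreasing in `u` for each `z` and
nondecreasing in `z` for each `u`. -/
noncomputable def π19 (z : Bool) (u : ℝ) : ℝ :=
  if z then (if u < 1/2 then u else 1) else u

/-- Example 6 (interaction in π at fixed X may break one chain even under Z ⫫ U):
with `U` uniform on `[0,1]` independent of `Z`, the Bayes posteriors (ratios of interval
integrals of `π` resp. `1 − π`) satisfy `P(U > 1/2 | Z = 1, X = 1) = 0.8`,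
`P(U > 1/2 | Z = 0, X = 1) = 0.75`, `P(U > 1/2 | Z = 1, X = 0) = 0`,
`P(U > 1/2 | Z = 0, X = 0) = 0.25`; the `X = 1` chain fails (`0.75 < 0.8`) while the
two-step dominance `P(U > 1/2 | Z = 0, X = 1) ≥ P(U > 1/2 | Z = 1, X = 0)` still holds. -/
theorem stmt19 :
    (∫ u in (1/2 : ℝ)..1, π19 true u) / (∫ u in (0 : ℝ)..1, π19 true u) = 0.8
    ∧ (∫ u in (1/2 : ℝ)..1, π19 false u) / (∫ u in (0 : ℝ)..1, π19 false u) = 0.75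
    ∧ (∫ u in (1/2 : ℝ)..1, (1 - π19 true u)) / (∫ u in (0 : ℝ)..1, (1 - π19 true u)) = 0
    ∧ (∫ u in (1/2 : ℝ)..1, (1 - π19 false u)) / (∫ u in (0 : ℝ)..1, (1 - π19 false u)) = 0.25
    ∧ (∫ u in (1/2 : ℝ)..1, π19 false u) / (∫ u in (0 : ℝ)..1, π19 false u)
        < (∫ u in (1/2 : ℝ)..1, π19 true u) / (∫ u in (0 : ℝ)..1, π19 true u)
    ∧ (∫ u in (1/2 : ℝ)..1, (1 - π19 true u)) / (∫ u in (0 : ℝ)..1, (1 - π19 true u))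
        ≤ (∫ u in (1/2 : ℝ)..1, π19 false u) / (∫ u in (0 : ℝ)..1, π19 false u) := by
  have hmono : Monotone (π19 true) := by
    intro a b hab
    simp only [π19, if_true]
    split_ifs <;> linarith
  have hint : ∀ a b : ℝ, IntervalIntegrable (π19 true) volume a b := fun a b =>
    hmono.intervalIntegrable
  have hf : π19 false = fun u => u := by
    funext u; simp [π19]
  have A : (∫ u in (1/2 : ℝ)..1, π19 true u) = 1/2 := by
    have : (∫ u in (1/2 : ℝ)..1, π19 true u) = ∫ u in (1/2 : ℝ)..1, (1:ℝ) := by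
      apply intervalIntegral.integral_congr
      intro u hu
      rw [Set.uIcc_of_le (by norm_num)] at hu
      have h : ¬ u < 1/2 := not_lt.mpr hu.1
      simp only [π19, if_true, if_neg h]
    rw [this, intervalIntegral.integral_const]; norm_num
  have B : (∫ u in (0 : ℝ)..(1/2), π19 true u) = 1/8 := by
    have : (∫ u in (0 : ℝ)..(1/2), π19 true u) = ∫ u in (0 : ℝ)..(1/2), u := by
      apply intervalIntegral.integral_congr_ae
      have h0 : ∀ᵐ u : ℝ, u ≠ 1/2 := by
        simp [ae_iff]
      filter_upwards [h0] with u hne hu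
      rw [Set.uIoc_of_le (by norm_num)] at hu
      have h : u < 1/2 := lt_of_le_of_ne hu.2 hne
      simp only [π19, if_true, if_pos h]
    rw [this, integral_id]; norm_num
  have C : (∫ u in (0 : ℝ)..1, π19 true u) = 5/8 := by
    rw [← intervalIntegral.integral_add_adjacent_intervals (hint 0 (1/2)) (hint (1/2) 1), A, B]
    norm_num
  have D : (∫ u in (1/2 : ℝ)..1, π19 false u) = 3/8 := by
    rw [hf, integral_id]; norm_num
  have E : (∫ u in (0 : ℝ)..1, π19 false u) = 1/2 := by
    rw [hf, integral_id]; norm_num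
  have hintf : ∀ a b : ℝ, IntervalIntegrable (π19 false) volume a b := fun a b => by
    rw [hf]; exact continuous_id.intervalIntegrable a b
  have S : ∀ (z : Bool) (a b : ℝ), (∫ u in a..b, (1 - π19 z u))
      = (b - a) - ∫ u in a..b, π19 z u := by
    intro z a b
    have hz : IntervalIntegrable (π19 z) volume a b := by
      cases z
      · exact hintf a b
      · exact hint a b
    rw [intervalIntegral.integral_sub intervalIntegrable_const hz, intervalIntegral.integral_const]
    simp
  simp only [S, A, C, D, E]
  norm_num
end
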